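/- Let U be a seed transformation with blocks as above, and let 𝔰 ⊆ F_2^{2m} be the row space of Σ_M. Then a vector M′ ∈ F_2^{2m} is the endpoint of an edge of physical weight 0 — i.e., there exist M ∈ F_2^{2m}, L ∈ F_2^{2k}, S ∈ F_2^{n−k} with (M:L:S) U_eff = (0_{2n} : M′) — if and only if M′ ∈ 𝔰^⊥ (the orthogonal complement of 𝔰 under the Λ_m-symplectic product). Moreover, for each M′ ∈ 𝔰^⊥ the triple (M,L,S) is unique. -/

import Mathlib

open Matrix

/-- The 2N×2N binary matrix Λ_N, block diagonal with N copies of [[0,1],[1,0]]. -/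
def lambdaMat (N : ℕ) : Matrix (Fin (2 * N)) (Fin (2 * N)) (ZMod 2) :=
  Matrix.of fun i j => if i.val / 2 = j.val / 2 ∧ i ≠ j then 1 else 0

/-- The symplectic product P ⋆ Q = P Λ_N Qᵀ of row vectors P, Q ∈ F_2^{2N}. -/
def sstar {N : ℕ} (P Q : Fin (2 * N) → ZMod 2) : ZMod 2 :=
  Matrix.vecMul P (lambdaMat N) ⬝ᵥ Q

/-- A 2N×2N binary matrix is symplectic if U Λ_N Uᵀ = Λ_N.  A seed transformation of a
quantum convolutional encoder with parameters (n,k,m) is a symplectic 2(n+m)×2(n+m) matrix. -/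
def IsSymplectic {N : ℕ} (U : Matrix (Fin (2 * N)) (Fin (2 * N)) (ZMod 2)) : Prop :=
  U * lambdaMat N * Uᵀ = lambdaMat N


/-- The block μ_P of a seed transformation: rows 1..2m, first 2n columns. -/
def muP (n m : ℕ) (U : Matrix (Fin (2 * (n + m))) (Fin (2 * (n + m))) (ZMod 2)) :
    Matrix (Fin (2 * m)) (Fin (2 * n)) (ZMod 2) :=
  Matrix.of fun i j =>
    U ⟨i.val, by have := i.isLt; omega⟩ ⟨j.val, by have := j.isLt; omega⟩

/-- The block μ_M of a seed transformation: rows 1..2m, last 2m columns. -/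
def muM (n m : ℕ) (U : Matrix (Fin (2 * (n + m))) (Fin (2 * (n + m))) (ZMod 2)) :
    Matrix (Fin (2 * m)) (Fin (2 * m)) (ZMod 2) :=
  Matrix.of fun i j =>
    U ⟨i.val, by have := i.isLt; omega⟩ ⟨2 * n + j.val, by have := j.isLt; omega⟩

/-- The block Λ_P of a seed transformation: rows 2m+1..2m+2k, first 2n columns. -/
def lamP (n k m : ℕ) (hk : k ≤ n)
    (U : Matrix (Fin (2 * (n + m))) (Fin (2 * (n + m))) (ZMod 2)) :
    Matrix (Fin (2 * k)) (Fin (2 * n)) (ZMod 2) :=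
  Matrix.of fun i j =>
    U ⟨2 * m + i.val, by have := i.isLt; omega⟩ ⟨j.val, by have := j.isLt; omega⟩

/-- The block Λ_M of a seed transformation: rows 2m+1..2m+2k, last 2m columns. -/
def lamM (n k m : ℕ) (hk : k ≤ n)
    (U : Matrix (Fin (2 * (n + m))) (Fin (2 * (n + m))) (ZMod 2)) :
    Matrix (Fin (2 * k)) (Fin (2 * m)) (ZMod 2) :=
  Matrix.of fun i j =>
    U ⟨2 * m + i.val, by have := i.isLt; omega⟩ ⟨2 * n + j.val, by have := j.isLt; omega⟩

/-- The block Σ_P of a seed transformation: rows of index 2m+2k+2i (1-indexed,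
i = 1,…,n−k), first 2n columns. -/
def sigP (n k m : ℕ)
    (U : Matrix (Fin (2 * (n + m))) (Fin (2 * (n + m))) (ZMod 2)) :
    Matrix (Fin (n - k)) (Fin (2 * n)) (ZMod 2) :=
  Matrix.of fun i j =>
    U ⟨2 * m + 2 * k + 2 * i.val + 1, by have := i.isLt; omega⟩
      ⟨j.val, by have := j.isLt; omega⟩

/-- The block Σ_M of a seed transformation: rows of index 2m+2k+2i (1-indexed,
i = 1,…,n−k), last 2m columns. -/
def sigM (n k m : ℕ)
    (U : Matrix (Fin (2 * (n + m))) (Fin (2 * (n + m))) (ZMod 2)) :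
    Matrix (Fin (n - k)) (Fin (2 * m)) (ZMod 2) :=
  Matrix.of fun i j =>
    U ⟨2 * m + 2 * k + 2 * i.val + 1, by have := i.isLt; omega⟩
      ⟨2 * n + j.val, by have := j.isLt; omega⟩


/-- (M:L:S) U_eff = (0_{2n} : M′): an edge of physical weight 0 (with syndrome input S)
from M to M′ with logical label L in the state diagram of the seed transformation U. -/
def ZeroPhysEdge (n k m : ℕ) (hk : k ≤ n)
    (U : Matrix (Fin (2 * (n + m))) (Fin (2 * (n + m))) (ZMod 2))
    (M : Fin (2 * m) → ZMod 2) (L : Fin (2 * k) → ZMod 2)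
    (S : Fin (n - k) → ZMod 2) (M' : Fin (2 * m) → ZMod 2) : Prop :=
  Matrix.vecMul M (muP n m U) + Matrix.vecMul L (lamP n k m hk U)
      + Matrix.vecMul S (sigP n k m U) = 0 ∧
  Matrix.vecMul M (muM n m U) + Matrix.vecMul L (lamM n k m hk U)
      + Matrix.vecMul S (sigM n k m U) = M'

/-- The orthogonal complement of a subspace W ⊆ F_2^{2m} under the symplectic product. -/
def sperp (m : ℕ) (W : Submodule (ZMod 2) (Fin (2 * m) → ZMod 2)) :
    Set (Fin (2 * m) → ZMod 2) :=
  {M | ∀ T ∈ W, sstar M T = 0}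

/-- The index paired with `i` by the symplectic form: the other element of its block of two. -/
def pairIdx {N : ℕ} (i : Fin (2 * N)) : Fin (2 * N) :=
  ⟨i.val + 1 - 2 * (i.val % 2), by have := i.isLt; omega⟩

lemma pairIdx_pairIdx {N : ℕ} (i : Fin (2 * N)) : pairIdx (pairIdx i) = i := by
  ext
  simp only [pairIdx]
  omega

lemma lambdaMat_apply {N : ℕ} (i j : Fin (2 * N)) :
    lambdaMat N i j = if i = pairIdx j then 1 else 0 := by
  simp only [lambdaMat, Matrix.of_apply, Fin.ext_iff, pairIdx, ne_eq]
  exact if_congr (by omega) rfl rfl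

lemma vecMul_lambdaMat {N : ℕ} (v : Fin (2 * N) → ZMod 2) (j : Fin (2 * N)) :
    Matrix.vecMul v (lambdaMat N) j = v (pairIdx j) := by
  simp [Matrix.vecMul, dotProduct, lambdaMat_apply]

lemma lambdaMat_mul_self (N : ℕ) : lambdaMat N * lambdaMat N = 1 := by
  ext i j
  have h : (lambdaMat N * lambdaMat N) i j = lambdaMat N i (pairIdx j) :=
    vecMul_lambdaMat (lambdaMat N i) j
  rw [h, lambdaMat_apply, pairIdx_pairIdx, Matrix.one_apply]

lemma sstar_eq_sum {N : ℕ} (P Q : Fin (2 * N) → ZMod 2) :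
    sstar P Q = ∑ j, P (pairIdx j) * Q j := by
  simp [sstar, dotProduct, vecMul_lambdaMat]

/-- A symplectic matrix has the two-sided inverse `Λ Uᵀ Λ`. -/
lemma IsSymplectic.mul_inverse {N : ℕ} {U : Matrix (Fin (2 * N)) (Fin (2 * N)) (ZMod 2)}
    (hU : IsSymplectic U) : U * (lambdaMat N * Uᵀ * lambdaMat N) = 1 := by
  unfold IsSymplectic at hU
  rw [← Matrix.mul_assoc, ← Matrix.mul_assoc, hU, lambdaMat_mul_self]

/-- The solution of `w U = v` has as coordinates the symplectic products of `v` with the rows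
of `U`. -/
lemma IsSymplectic.vecMul_eq_iff {N : ℕ} {U : Matrix (Fin (2 * N)) (Fin (2 * N)) (ZMod 2)}
    (hU : IsSymplectic U) (w v : Fin (2 * N) → ZMod 2) :
    Matrix.vecMul w U = v ↔ w = fun j => sstar v (U (pairIdx j)) := by
  have key : Matrix.vecMul v (lambdaMat N * Uᵀ * lambdaMat N)
      = fun j => sstar v (U (pairIdx j)) := by
    funext j
    rw [← Matrix.vecMul_vecMul, vecMul_lambdaMat, ← Matrix.vecMul_vecMul]
    rfl
  rw [← key]
  constructor
  · rintro rfl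
    rw [Matrix.vecMul_vecMul, hU.mul_inverse, Matrix.vecMul_one]
  · rintro rfl
    rw [Matrix.vecMul_vecMul, mul_eq_one_comm.mp hU.mul_inverse, Matrix.vecMul_one]

/-- Column indices of a seed transformation: physical columns, then memory columns. -/
def colIdx (n m : ℕ) : Fin (2 * n) ⊕ Fin (2 * m) → Fin (2 * (n + m)) :=
  Sum.elim (fun j => ⟨j.val, by have := j.isLt; omega⟩)
    (fun j => ⟨2 * n + j.val, by have := j.isLt; omega⟩)

lemma colIdx_bijective (n m : ℕ) : Function.Bijective (colIdx n m) := by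
  rw [Fintype.bijective_iff_injective_and_card]
  refine ⟨?_, by simp; ring⟩
  rintro (a | a) (b | b) h <;>
    simp only [colIdx, Sum.elim_inl, Sum.elim_inr, Sum.inl.injEq, Sum.inr.injEq,
      Fin.ext_iff, reduceCtorEq] at h ⊢ <;> omega

/-- Row indices of a seed transformation: memory rows, logical rows, the rows kept in `Σ`, and
the syndrome rows that are dropped. -/
def rowIdx (n k m : ℕ) (hk : k ≤ n) :
    Fin (2 * m) ⊕ Fin (2 * k) ⊕ Fin (n - k) ⊕ Fin (n - k) → Fin (2 * (n + m)) :=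
  Sum.elim (fun i => ⟨i.val, by have := i.isLt; omega⟩) <|
  Sum.elim (fun i => ⟨2 * m + i.val, by have := i.isLt; omega⟩) <|
  Sum.elim (fun i => ⟨2 * m + 2 * k + 2 * i.val + 1, by have := i.isLt; omega⟩)
    (fun i => ⟨2 * m + 2 * k + 2 * i.val, by have := i.isLt; omega⟩)

lemma rowIdx_bijective (n k m : ℕ) (hk : k ≤ n) : Function.Bijective (rowIdx n k m hk) := by
  rw [Fintype.bijective_iff_injective_and_card]
  refine ⟨?_, by simp; omega⟩
  rintro (a | a | a | a) (b | b | b | b) h <;>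
    simp only [rowIdx, Sum.elim_inl, Sum.elim_inr, Sum.inl.injEq, Sum.inr.injEq,
      Fin.ext_iff, reduceCtorEq] at h ⊢ <;> omega

lemma pairIdx_rowIdx_dropped (n k m : ℕ) (hk : k ≤ n) (i : Fin (n - k)) :
    pairIdx (rowIdx n k m hk (.inr (.inr (.inr i)))) = rowIdx n k m hk (.inr (.inr (.inl i))) := by
  ext
  simp only [pairIdx, rowIdx, Sum.elim_inl, Sum.elim_inr]
  omega

/-- The symplectic product of `(0 : M')` with a vector only sees the memory part of the latter. -/
lemma sstar_of_comp_colIdx {n m : ℕ} {M' : Fin (2 * m) → ZMod 2}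
    {v : Fin (2 * (n + m)) → ZMod 2} (hv : v ∘ colIdx n m = Sum.elim (0 : Fin (2 * n) → ZMod 2) M')
    (r : Fin (2 * (n + m)) → ZMod 2) :
    sstar v r = sstar M' fun j => r (colIdx n m (.inr j)) := by
  have hl (j) : v (pairIdx (colIdx n m (.inl j))) = 0 := by
    have h : pairIdx (colIdx n m (.inl j)) = colIdx n m (.inl (pairIdx j)) := rfl
    rw [h]
    exact congrFun hv (.inl (pairIdx j))
  have hr (j) : v (pairIdx (colIdx n m (.inr j))) = M' (pairIdx j) := by
    have h : pairIdx (colIdx n m (.inr j)) = colIdx n m (.inr (pairIdx j)) := by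
      ext
      simp only [pairIdx, colIdx, Sum.elim_inr]
      omega
    rw [h]
    exact congrFun hv (.inr (pairIdx j))
  rw [sstar_eq_sum, sstar_eq_sum, ← (colIdx_bijective n m).sum_comp, Fintype.sum_sum_type]
  simp [hl, hr]

lemma vecMul_of_comp_rowIdx {n k m : ℕ} {hk : k ≤ n}
    (U : Matrix (Fin (2 * (n + m))) (Fin (2 * (n + m))) (ZMod 2))
    {M : Fin (2 * m) → ZMod 2} {L : Fin (2 * k) → ZMod 2} {S : Fin (n - k) → ZMod 2}
    {w : Fin (2 * (n + m)) → ZMod 2}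
    (hw : w ∘ rowIdx n k m hk = Sum.elim M (Sum.elim L (Sum.elim S (0 : Fin (n - k) → ZMod 2)))) (c : Fin (2 * (n + m))) :
    Matrix.vecMul w U c = ∑ i, M i * U (rowIdx n k m hk (.inl i)) c
      + ∑ i, L i * U (rowIdx n k m hk (.inr (.inl i))) c
      + ∑ i, S i * U (rowIdx n k m hk (.inr (.inr (.inl i)))) c := by
  have hw' (x) : w (rowIdx n k m hk x) = _ := congrFun hw x
  rw [Matrix.vecMul, dotProduct, ← (rowIdx_bijective n k m hk).sum_comp]
  simp [Fintype.sum_sum_type, hw', add_assoc]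

lemma zeroPhysEdge_iff {n k m : ℕ} {hk : k ≤ n}
    (U : Matrix (Fin (2 * (n + m))) (Fin (2 * (n + m))) (ZMod 2))
    {M : Fin (2 * m) → ZMod 2} {L : Fin (2 * k) → ZMod 2} {S : Fin (n - k) → ZMod 2}
    {M' : Fin (2 * m) → ZMod 2} {v w : Fin (2 * (n + m)) → ZMod 2}
    (hv : v ∘ colIdx n m = Sum.elim (0 : Fin (2 * n) → ZMod 2) M')
    (hw : w ∘ rowIdx n k m hk = Sum.elim M (Sum.elim L (Sum.elim S (0 : Fin (n - k) → ZMod 2)))) :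
    ZeroPhysEdge n k m hk U M L S M' ↔ Matrix.vecMul w U = v := by
  rw [← (colIdx_bijective n m).surjective.injective_comp_right.eq_iff, hv, funext_iff,
    Sum.forall, ZeroPhysEdge, funext_iff, funext_iff]
  simp only [Function.comp_apply, vecMul_of_comp_rowIdx U hw]
  rfl

/-- The only candidate `(M : L : S)` for an edge of physical weight 0 ending in `M'` is read off
from the symplectic products of `(0 : M')` with the rows of `U`. -/
lemma IsSymplectic.zeroPhysEdge_iff {n k m : ℕ} {hk : k ≤ n}
    {U : Matrix (Fin (2 * (n + m))) (Fin (2 * (n + m))) (ZMod 2)} (hU : IsSymplectic U)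
    {M : Fin (2 * m) → ZMod 2} {L : Fin (2 * k) → ZMod 2} {S : Fin (n - k) → ZMod 2}
    {M' : Fin (2 * m) → ZMod 2} {v : Fin (2 * (n + m)) → ZMod 2}
    (hv : v ∘ colIdx n m = Sum.elim (0 : Fin (2 * n) → ZMod 2) M') :
    ZeroPhysEdge n k m hk U M L S M' ↔
      Sum.elim M (Sum.elim L (Sum.elim S (0 : Fin (n - k) → ZMod 2))) =
        fun x => sstar v (U (pairIdx (rowIdx n k m hk x))) := by
  obtain ⟨w, hw⟩ := (rowIdx_bijective n k m hk).injective.surjective_comp_right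
    (Sum.elim M (Sum.elim L (Sum.elim S (0 : Fin (n - k) → ZMod 2))))
  rw [_root_.zeroPhysEdge_iff U hv hw, hU.vecMul_eq_iff, ← hw,
    ← (rowIdx_bijective n k m hk).surjective.injective_comp_right.eq_iff]
  rfl

lemma mem_sperp_span_range {m : ℕ} {ι : Type*} (T : ι → Fin (2 * m) → ZMod 2)
    (M : Fin (2 * m) → ZMod 2) :
    M ∈ sperp m (Submodule.span (ZMod 2) (Set.range T)) ↔ ∀ i, sstar M (T i) = 0 := by
  refine ⟨fun h i => h _ (Submodule.subset_span ⟨i, rfl⟩), fun h x hx => ?_⟩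
  induction hx using Submodule.span_induction with
  | mem x hx => obtain ⟨i, rfl⟩ := hx; exact h i
  | zero => simp [sstar]
  | add x y _ _ hx hy => simp_all [sstar, dotProduct_add]
  | smul a x _ hx => simp_all [sstar, dotProduct_smul]

/-- M′ is the endpoint of an edge of physical weight 0 iff M′ lies in the
symplectic orthogonal complement of the row space 𝔰 of Σ_M; moreover the corresponding
triple (M,L,S) is unique. -/
theorem stmt_12 (n k m : ℕ) (hn : 1 ≤ n) (hk : k ≤ n) (hm : 1 ≤ m)
    (U : Matrix (Fin (2 * (n + m))) (Fin (2 * (n + m))) (ZMod 2))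
    (hU : IsSymplectic U)
    (M' : Fin (2 * m) → ZMod 2) :
    ((∃ (M : Fin (2 * m) → ZMod 2) (L : Fin (2 * k) → ZMod 2) (S : Fin (n - k) → ZMod 2),
        ZeroPhysEdge n k m hk U M L S M')
      ↔ M' ∈ sperp m (Submodule.span (ZMod 2) (Set.range fun i => sigM n k m U i))) ∧
    (∀ (M₁ M₂ : Fin (2 * m) → ZMod 2) (L₁ L₂ : Fin (2 * k) → ZMod 2)
        (S₁ S₂ : Fin (n - k) → ZMod 2),
        ZeroPhysEdge n k m hk U M₁ L₁ S₁ M' → ZeroPhysEdge n k m hk U M₂ L₂ S₂ M' →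
        M₁ = M₂ ∧ L₁ = L₂ ∧ S₁ = S₂) := by
  obtain ⟨v, hv⟩ :=
    (colIdx_bijective n m).injective.surjective_comp_right (Sum.elim (0 : Fin (2 * n) → ZMod 2) M')
  refine ⟨?_, fun M₁ M₂ L₁ L₂ S₁ S₂ h₁ h₂ => ?_⟩
  · have hdropped (i) : sstar v (U (pairIdx (rowIdx n k m hk (.inr (.inr (.inr i))))))
        = sstar M' (sigM n k m U i) := by
      rw [pairIdx_rowIdx_dropped, sstar_of_comp_colIdx hv]
      rfl
    simp only [hU.zeroPhysEdge_iff hv, mem_sperp_span_range, ← hdropped]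
    constructor
    · rintro ⟨M, L, S, h⟩ i
      exact (congrFun h (.inr (.inr (.inr i)))).symm
    · intro h
      refine ⟨fun i => sstar v (U (pairIdx (rowIdx n k m hk (.inl i)))),
        fun i => sstar v (U (pairIdx (rowIdx n k m hk (.inr (.inl i))))),
        fun i => sstar v (U (pairIdx (rowIdx n k m hk (.inr (.inr (.inl i)))))), ?_⟩
      funext x
      rcases x with i | i | i | i
      exacts [rfl, rfl, rfl, (h i).symm]
  · rw [hU.zeroPhysEdge_iff hv] at h₁ h₂
    simpa [Sum.elim_eq_iff] using h₁.trans h₂.symm
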